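/- Under the hypotheses: there is τ > 0 such that every x ∈ 𝒟 with E_f(x) < τ satisfies (a) x ∈ D, (b) ‖x − T(x)‖ ⪯ γ(E_f(x))·‖W_f(x)‖, (c) ‖W_f(T(x))‖ ⪯ β(E_f(x))·‖W_f(x)‖, with β quasi-homogeneous of degree m ≥ 0 on [0,τ), γ nondecreasing and positive on [0,τ), ψ(t) = 1 − b·t·γ(t) positive on [0,τ), and x⁽⁰⁾ ∈ 𝒟 satisfies E_f(x⁽⁰⁾) < τ and φ(E_f(x⁽⁰⁾)) < 1 where φ = β/ψ: the polynomial f has n simple zeros in K, and for every k ≥ 0 the closed disks D_i^k = {z ∈ K : |z − x_i⁽ᵏ⁾| ≤ r_i⁽ᵏ⁾}, i = 1,…,n, with radii r_i⁽ᵏ⁾ = (γ(E_f(x⁽ᵏ⁾))/(1 − β(E_f(x⁽ᵏ⁾))))·|W_i(x⁽ᵏ⁾)|, are mutually disjoint and each contains exactly one zero of f; here x⁽ᵏ⁺¹⁾ = T(x⁽ᵏ⁾). (Theorem 2.2 (vi)) -/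

import Mathlib

open Finset Polynomial Filter

noncomputable section

/-- The Weierstrass correction `W_i(x) = f(x_i)/(C₀ ∏_{j≠i}(x_i − x_j))`. -/
def Wc {n : ℕ} {K : Type*} [NormedField K] (f : Polynomial K) (x : Fin n → K) (i : Fin n) : K :=
  eval (x i) f / (f.leadingCoeff * ∏ j ∈ univ.erase i, (x i - x j))

/-- `dmin x i = min_{j ≠ i} ‖x i - x j‖`. -/
def dmin {n : ℕ} {K : Type*} [NormedField K] (x : Fin n → K) (i : Fin n) : ℝ :=
  if h : (univ.erase i).Nonempty then (univ.erase i).inf' h fun j => ‖x i - x j‖ else 0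

/-- `E_f(x)` : the ℓ^p norm of the vector `(‖W_i(x)‖ / d_i(x))_i`. -/
def Ef {n : ℕ} {K : Type*} [NormedField K] (p : ENNReal) (f : Polynomial K)
    (x : Fin n → K) : ℝ :=
  ‖(WithLp.equiv p (Fin n → ℝ)).symm (fun i => ‖Wc f x i‖ / dmin x i)‖

/-- `σ_i(x) = Σ_{j≠i} W_j(x)/(x_i − x_j)`. -/
def sigmaf {n : ℕ} {K : Type*} [NormedField K] (f : Polynomial K) (x : Fin n → K)
    (i : Fin n) : K :=
  ∑ j ∈ univ.erase i, Wc f x j / (x i - x j)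

/-- The Ehrlich iteration function. -/
def PhiE {n : ℕ} {K : Type*} [NormedField K] (f : Polynomial K) (x : Fin n → K) : Fin n → K :=
  fun i => x i - Wc f x i / (1 + sigmaf f x i)

/-- The Prešić–Tanabe iteration function. -/
def TnbE {n : ℕ} {K : Type*} [NormedField K] (f : Polynomial K) (x : Fin n → K) : Fin n → K :=
  fun i => x i - Wc f x i * (1 - sigmaf f x i)

/-- `ξ` is a root vector of `f`, i.e. `f(z) = C₀ ∏ (z − ξᵢ)`. -/
def IsRootVector {n : ℕ} {K : Type*} [NormedField K] (f : Polynomial K) (ξ : Fin n → K) : Prop :=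
  f = C f.leadingCoeff * ∏ i, (X - C (ξ i))

/-- `E_f(x)` in the case `p = ∞`: the max of `‖W_i(x)‖ / d_i(x)`. -/
def Einf {n : ℕ} {K : Type*} [NormedField K] (f : Polynomial K) (x : Fin n → K) : ℝ :=
  if h : (univ : Finset (Fin n)).Nonempty then univ.sup' h fun i => ‖Wc f x i‖ / dmin x i else 0

theorem norm_toLp_le_of_le {ι : Type*} [Fintype ι] {p : ENNReal} (hp : 1 ≤ p) {v w : ι → ℝ}
    (hv : ∀ i, 0 ≤ v i) (hvw : ∀ i, v i ≤ w i) :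
    ‖(WithLp.toLp p v : PiLp p fun _ : ι => ℝ)‖ ≤ ‖(WithLp.toLp p w : PiLp p fun _ : ι => ℝ)‖ := by
  rcases eq_or_ne p ⊤ with rfl | htop
  · rw [PiLp.norm_toLp, PiLp.norm_toLp]
    exact (pi_norm_le_iff_of_nonneg (norm_nonneg _)).2 fun i =>
      (abs_le_abs_of_nonneg (hv i) (hvw i)).trans (norm_le_pi_norm w i)
  · have hpos : 0 < p.toReal := ENNReal.toReal_pos (zero_lt_one.trans_le hp).ne' htop
    rw [PiLp.norm_eq_sum hpos, PiLp.norm_eq_sum hpos]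
    simp only [Real.norm_of_nonneg (hv _), Real.norm_of_nonneg ((hv _).trans (hvw _))]
    gcongr with i
    exacts [Finset.sum_nonneg fun i _ => Real.rpow_nonneg (hv i) _, hv i, hvw i]

theorem add_le_two_rpow_mul_norm_toLp {ι : Type*} [Fintype ι] {p q : ENNReal} (hp : 1 ≤ p)
    (hpq : p⁻¹ + q⁻¹ = 1) {v : ι → ℝ} (hv : ∀ i, 0 ≤ v i) {i j : ι} (hij : i ≠ j) :
    v i + v j ≤ (2 : ℝ) ^ (q⁻¹).toReal * ‖(WithLp.toLp p v : PiLp p fun _ : ι => ℝ)‖ := by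
  classical
  rcases eq_or_ne p ⊤ with rfl | htop
  · have hq : q⁻¹ = 1 := by simpa using hpq
    have hi := norm_le_pi_norm v i
    have hj := norm_le_pi_norm v j
    rw [Real.norm_of_nonneg (hv _)] at hi hj
    rw [PiLp.norm_toLp, hq]
    simp only [ENNReal.toReal_one, Real.rpow_one]
    linarith
  · have hp1 : 1 ≤ p.toReal := by simpa using (ENNReal.toReal_le_toReal ENNReal.one_ne_top htop).2 hp
    have hpos : 0 < p.toReal := by linarith
    have hpi : p⁻¹ ≠ ⊤ := ENNReal.inv_ne_top.2 (zero_lt_one.trans_le hp).ne'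
    have hqi : q⁻¹ ≠ ⊤ := fun h => by simp [h] at hpq
    have hsum : p.toReal⁻¹ + (q⁻¹).toReal = 1 := by
      rw [← ENNReal.toReal_inv, ← ENNReal.toReal_add hpi hqi, hpq, ENNReal.toReal_one]
    have hpair : v i ^ p.toReal + v j ^ p.toReal ≤ ∑ k, v k ^ p.toReal := by
      rw [← Finset.sum_pair (f := fun k => v k ^ p.toReal) hij]
      exact Finset.sum_le_sum_of_subset_of_nonneg (Finset.subset_univ _)
        fun k _ _ => Real.rpow_nonneg (hv k) _
    rw [PiLp.norm_eq_sum hpos]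
    simp only [Real.norm_of_nonneg (hv _)]
    have hnn : 0 ≤ ∑ k, v k ^ p.toReal := Finset.sum_nonneg fun k _ => Real.rpow_nonneg (hv k) _
    have hexp : (q⁻¹).toReal * p.toReal = p.toReal - 1 := by
      have := mul_inv_cancel₀ hpos.ne'
      linear_combination p.toReal * hsum - this
    refine (Real.rpow_le_rpow_iff (add_nonneg (hv i) (hv j)) (by positivity) hpos).1 ?_
    rw [Real.mul_rpow (by positivity) (by positivity), ← Real.rpow_mul zero_le_two,
      ← Real.rpow_mul hnn, hexp, one_div, inv_mul_cancel₀ hpos.ne', Real.rpow_one]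
    have hconv := NNReal.rpow_add_le_mul_rpow_add_rpow ⟨v i, hv i⟩ ⟨v j, hv j⟩ hp1
    rw [← NNReal.coe_le_coe] at hconv
    push_cast at hconv
    exact hconv.trans (mul_le_mul_of_nonneg_left hpair (by positivity))

section Weierstrass

variable {n : ℕ} {K : Type*} [NormedField K]

theorem dmin_le_norm_sub (x : Fin n → K) {i j : Fin n} (hij : i ≠ j) :
    dmin x i ≤ ‖x i - x j‖ := by
  have hj : j ∈ univ.erase i := Finset.mem_erase.2 ⟨hij.symm, Finset.mem_univ j⟩
  rw [dmin, dif_pos ⟨j, hj⟩]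
  exact Finset.inf'_le _ hj

theorem exists_dmin_eq (hn : 2 ≤ n) (x : Fin n → K) (i : Fin n) :
    ∃ j, i ≠ j ∧ dmin x i = ‖x i - x j‖ := by
  have : Nontrivial (Fin n) := Fin.nontrivial_iff_two_le.2 hn
  have hne : (univ.erase i).Nonempty := by
    obtain ⟨j, hj⟩ := exists_ne i
    exact ⟨j, Finset.mem_erase.2 ⟨hj, Finset.mem_univ j⟩⟩
  obtain ⟨j, hj, h⟩ := Finset.exists_mem_eq_inf' hne fun j => ‖x i - x j‖
  exact ⟨j, (Finset.ne_of_mem_erase hj).symm, by rw [dmin, dif_pos hne, h]⟩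

theorem dmin_pos (hn : 2 ≤ n) {x : Fin n → K} (hx : Function.Injective x) (i : Fin n) :
    0 < dmin x i := by
  obtain ⟨j, hij, h⟩ := exists_dmin_eq hn x i
  rw [h, norm_pos_iff, sub_ne_zero]
  exact hx.ne hij

theorem dmin_nonneg (x : Fin n → K) (i : Fin n) : 0 ≤ dmin x i := by
  rw [dmin]
  split_ifs with h
  · exact Finset.le_inf' h _ fun j _ => norm_nonneg _
  · exact le_rfl

theorem Ef_nonneg {p : ENNReal} (hp : 1 ≤ p) (f : Polynomial K) (x : Fin n → K) :
    0 ≤ Ef p f x := by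
  have : Fact (1 ≤ p) := ⟨hp⟩
  exact norm_nonneg (WithLp.toLp p _ : PiLp p fun _ : Fin n => ℝ)

theorem norm_Wc_add_norm_Wc_le (hn : 2 ≤ n) {p q : ENNReal} (hp : 1 ≤ p) (hpq : p⁻¹ + q⁻¹ = 1)
    (f : Polynomial K) {x : Fin n → K} (hx : Function.Injective x) {i j : Fin n} (hij : i ≠ j) :
    ‖Wc f x i‖ + ‖Wc f x j‖ ≤ (2 : ℝ) ^ (q⁻¹).toReal * Ef p f x * ‖x i - x j‖ := by
  have bound {k l : Fin n} (hkl : k ≠ l) :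
      ‖Wc f x k‖ ≤ ‖Wc f x k‖ / dmin x k * ‖x k - x l‖ := by
    rw [div_mul_eq_mul_div, le_div_iff₀ (dmin_pos hn hx k)]
    gcongr
    exact dmin_le_norm_sub x hkl
  have hi := bound hij
  have hj := bound hij.symm
  rw [norm_sub_rev (x j)] at hj
  calc ‖Wc f x i‖ + ‖Wc f x j‖
      ≤ (‖Wc f x i‖ / dmin x i + ‖Wc f x j‖ / dmin x j) * ‖x i - x j‖ := by
        rw [add_mul]; exact add_le_add hi hj
    _ ≤ _ := by
        gcongr
        exact add_le_two_rpow_mul_norm_toLp (v := fun i => ‖Wc f x i‖ / dmin x i) hp hpq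
          (fun k => div_nonneg (norm_nonneg _) (dmin_nonneg x k)) hij

theorem mul_norm_sub_le_norm_sub (hn : 2 ≤ n) {p q : ENNReal} (hp : 1 ≤ p)
    (hpq : p⁻¹ + q⁻¹ = 1) (f : Polynomial K) {x u : Fin n → K} (hx : Function.Injective x)
    {c : ℝ} (hc : 0 ≤ c) (h : ∀ i, ‖x i - u i‖ ≤ c * ‖Wc f x i‖) {i j : Fin n} (hij : i ≠ j) :
    (1 - (2 : ℝ) ^ (q⁻¹).toReal * Ef p f x * c) * ‖x i - x j‖ ≤ ‖u i - u j‖ := by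
  have htri : ‖x i - x j‖ ≤ ‖x i - u i‖ + ‖u i - u j‖ + ‖x j - u j‖ := by
    rw [norm_sub_rev (x j)]
    calc ‖x i - x j‖ = ‖(x i - u i) + (u i - u j) + (u j - x j)‖ := by congr 1; ring
      _ ≤ _ := norm_add₃_le
  have hW := mul_le_mul_of_nonneg_left (norm_Wc_add_norm_Wc_le hn hp hpq f hx hij) hc
  have hi := h i
  have hj := h j
  linarith

theorem injective_of_norm_sub_le (hn : 2 ≤ n) {p q : ENNReal} (hp : 1 ≤ p)
    (hpq : p⁻¹ + q⁻¹ = 1) (f : Polynomial K) {x u : Fin n → K} (hx : Function.Injective x)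
    {c : ℝ} (hc : 0 ≤ c) (hpos : 0 < 1 - (2 : ℝ) ^ (q⁻¹).toReal * Ef p f x * c)
    (h : ∀ i, ‖x i - u i‖ ≤ c * ‖Wc f x i‖) : Function.Injective u := by
  intro i j huij
  by_contra hij
  have hle := mul_norm_sub_le_norm_sub hn hp hpq f hx hc h hij
  rw [huij, sub_self, norm_zero] at hle
  exact hle.not_gt (mul_pos hpos (norm_pos_iff.2 (sub_ne_zero.2 (hx.ne hij))))

theorem Ef_le_div_mul (hn : 2 ≤ n) {p q : ENNReal} (hp : 1 ≤ p)
    (hpq : p⁻¹ + q⁻¹ = 1) (f : Polynomial K) {x u : Fin n → K} (hx : Function.Injective x)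
    {c s : ℝ} (hc : 0 ≤ c) (hs : 0 ≤ s)
    (hpos : 0 < 1 - (2 : ℝ) ^ (q⁻¹).toReal * Ef p f x * c)
    (h : ∀ i, ‖x i - u i‖ ≤ c * ‖Wc f x i‖) (hW : ∀ i, ‖Wc f u i‖ ≤ s * ‖Wc f x i‖) :
    Ef p f u ≤ s / (1 - (2 : ℝ) ^ (q⁻¹).toReal * Ef p f x * c) * Ef p f x := by
  have : Fact (1 ≤ p) := ⟨hp⟩
  set ψ := 1 - (2 : ℝ) ^ (q⁻¹).toReal * Ef p f x * c
  set v : PiLp p fun _ : Fin n => ℝ := WithLp.toLp p fun i => ‖Wc f x i‖ / dmin x i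
  have hd (i : Fin n) : ψ * dmin x i ≤ dmin u i := by
    obtain ⟨j, hij, hj⟩ := exists_dmin_eq hn u i
    rw [hj]
    exact (mul_le_mul_of_nonneg_left (dmin_le_norm_sub x hij) hpos.le).trans
      (mul_norm_sub_le_norm_sub hn hp hpq f hx hc h hij)
  have key : ‖(WithLp.toLp p fun i => ‖Wc f u i‖ / dmin u i : PiLp p fun _ : Fin n => ℝ)‖ ≤
      ‖(s / ψ) • v‖ := by
    refine norm_toLp_le_of_le (w := (s / ψ) • fun i => ‖Wc f x i‖ / dmin x i) hp
      (fun i => div_nonneg (norm_nonneg _) (dmin_nonneg u i)) fun i => ?_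
    calc ‖Wc f u i‖ / dmin u i ≤ s * ‖Wc f x i‖ / (ψ * dmin x i) :=
          div_le_div₀ (by positivity) (hW i) (mul_pos hpos (dmin_pos hn hx i)) (hd i)
      _ = _ := by rw [Pi.smul_apply, smul_eq_mul, div_mul_div_comm]
  rwa [norm_smul, Real.norm_of_nonneg (div_nonneg hs hpos.le)] at key

theorem eval_eq_Wc_mul {f : Polynomial K} (hf : f ≠ 0) {x : Fin n → K}
    (hx : Function.Injective x) (i : Fin n) :
    eval (x i) f = Wc f x i * (f.leadingCoeff * ∏ j ∈ univ.erase i, (x i - x j)) := by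
  refine (div_mul_cancel₀ _ (mul_ne_zero (leadingCoeff_ne_zero.2 hf) ?_)).symm
  exact Finset.prod_ne_zero_iff.2 fun j hj =>
    sub_ne_zero.2 (hx.ne (Finset.ne_of_mem_erase hj).symm)

theorem exists_root_of_geometric [CompleteSpace K] {f : Polynomial K} (hf : f ≠ 0)
    {y : ℕ → Fin n → K} (hy : ∀ k, Function.Injective (y k)) {c r : ℝ} (hr0 : 0 ≤ r) (hr1 : r < 1)
    (hstep : ∀ k i, ‖y k i - y (k + 1) i‖ ≤ c * ‖Wc f (y 0) i‖ * r ^ k)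
    (hW : ∀ k i, ‖Wc f (y k) i‖ ≤ ‖Wc f (y 0) i‖ * r ^ k) :
    ∃ ξ : Fin n → K, ∀ i, ‖ξ i - y 0 i‖ ≤ c / (1 - r) * ‖Wc f (y 0) i‖ ∧ eval (ξ i) f = 0 := by
  have hdist (i : Fin n) (k : ℕ) : dist (y k i) (y (k + 1) i) ≤ c * ‖Wc f (y 0) i‖ * r ^ k := by
    rw [dist_eq_norm]
    exact hstep k i
  choose ξ hξ using fun i => cauchySeq_tendsto_of_complete
    (cauchySeq_of_le_geometric r _ hr1 (hdist i))
  refine ⟨ξ, fun i => ⟨?_, ?_⟩⟩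
  · have := dist_le_of_le_geometric_of_tendsto₀ r _ hr1 (hdist i) (hξ i)
    rwa [dist_comm, dist_eq_norm, mul_div_right_comm] at this
  · have hW0 : Tendsto (fun k => Wc f (y k) i) atTop (nhds 0) := by
      refine squeeze_zero_norm (fun k => hW k i) ?_
      simpa using (tendsto_pow_atTop_nhds_zero_of_lt_one hr0 hr1).const_mul ‖Wc f (y 0) i‖
    have hprod : Tendsto (fun k => f.leadingCoeff * ∏ j ∈ univ.erase i, (y k i - y k j)) atTop
        (nhds (f.leadingCoeff * ∏ j ∈ univ.erase i, (ξ i - ξ j))) :=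
      (tendsto_finsetProd _ fun j _ => (hξ i).sub (hξ j)).const_mul _
    have heval := (f.continuous.tendsto (ξ i)).comp (hξ i)
    refine tendsto_nhds_unique heval ?_
    have := hW0.mul hprod
    rw [zero_mul] at this
    exact this.congr fun k => (eval_eq_Wc_mul hf (hy k) i).symm

theorem isRootVector_of_injective {f : Polynomial K} (hdeg : f.degree = (n : ℕ)) {ξ : Fin n → K}
    (hξ : Function.Injective ξ) (hroot : ∀ i, eval (ξ i) f = 0) : IsRootVector f ξ := by
  have hnat : f.natDegree = n := natDegree_eq_of_degree_eq_some hdeg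
  have hf : f ≠ 0 := fun h => by simp [h] at hdeg
  have hle : (univ : Finset (Fin n)).val.map ξ ≤ f.roots := by
    refine (Multiset.le_iff_subset (univ.nodup.map hξ)).2 fun z hz => ?_
    obtain ⟨i, -, rfl⟩ := Multiset.mem_map.1 hz
    exact (mem_roots hf).2 (hroot i)
  have hroots : (univ : Finset (Fin n)).val.map ξ = f.roots :=
    Multiset.eq_of_le_of_card_le hle (by simpa [hnat] using f.card_roots')
  have hcard : Multiset.card f.roots = f.natDegree := by simp [← hroots, hnat]
  rw [IsRootVector, Finset.prod]
  conv_lhs => rw [← C_leadingCoeff_mul_prod_multiset_X_sub_C hcard, ← hroots, Multiset.map_map]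
  rfl

theorem IsRootVector.exists_eq_of_eval_eq_zero {f : Polynomial K} (hf : f ≠ 0) {ξ : Fin n → K}
    (h : IsRootVector f ξ) {z : K} (hz : eval z f = 0) : ∃ i, z = ξ i := by
  rw [h, eval_mul, eval_C, eval_prod, mul_eq_zero, Finset.prod_eq_zero_iff] at hz
  rcases hz with hz | ⟨i, -, hi⟩
  · exact absurd (leadingCoeff_eq_zero.1 hz) hf
  · exact ⟨i, by simpa [sub_eq_zero] using hi⟩

theorem disjoint_closedBall_of_add_lt (hn : 2 ≤ n) {p q : ENNReal} (hp : 1 ≤ p)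
    (hpq : p⁻¹ + q⁻¹ = 1) (f : Polynomial K) {x : Fin n → K} (hx : Function.Injective x)
    {c r : ℝ} (hc : 0 ≤ c) (hr1 : r < 1) (hr : r < 1 - (2 : ℝ) ^ (q⁻¹).toReal * Ef p f x * c)
    {i j : Fin n} (hij : i ≠ j) :
    Disjoint (Metric.closedBall (x i) (c / (1 - r) * ‖Wc f x i‖))
      (Metric.closedBall (x j) (c / (1 - r) * ‖Wc f x j‖)) := by
  refine Metric.closedBall_disjoint_closedBall ?_
  have h1r : 0 < 1 - r := sub_pos.2 hr1
  have hpos : 0 < ‖x i - x j‖ := norm_pos_iff.2 (sub_ne_zero.2 (hx.ne hij))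
  have hW := mul_le_mul_of_nonneg_left (norm_Wc_add_norm_Wc_le hn hp hpq f hx hij) hc
  have hlt := mul_lt_mul_of_pos_right hr hpos
  rw [dist_eq_norm, ← mul_add, div_mul_eq_mul_div, div_lt_iff₀ h1r]
  linarith

/-- Points at which a `(β, γ)`-controlled iteration is guaranteed to contract. -/
structure IsInitialPoint (p q : ENNReal) (f : Polynomial K) (τ : ℝ) (β γ : ℝ → ℝ)
    (x : Fin n → K) : Prop where
  injective : Function.Injective x
  Ef_lt : Ef p f x < τ
  lt_psi : β (Ef p f x) < 1 - (2 : ℝ) ^ (q⁻¹).toReal * Ef p f x * γ (Ef p f x)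

variable {p q : ENNReal} {f : Polynomial K} {T : (Fin n → K) → Fin n → K} {τ : ℝ} {β γ : ℝ → ℝ}

theorem IsInitialPoint.map (hn : 2 ≤ n) (hp : 1 ≤ p) (hpq : p⁻¹ + q⁻¹ = 1)
    (hβ0 : ∀ t, 0 ≤ t → t < τ → 0 ≤ β t) (hβmono : ∀ s t, 0 ≤ s → s ≤ t → t < τ → β s ≤ β t)
    (hγpos : ∀ t, 0 ≤ t → t < τ → 0 < γ t) (hγmono : ∀ s t, 0 ≤ s → s ≤ t → t < τ → γ s ≤ γ t)
    (hT : ∀ x : Fin n → K, Function.Injective x → Ef p f x < τ →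
      (∀ i, ‖x i - T x i‖ ≤ γ (Ef p f x) * ‖Wc f x i‖) ∧
        (∀ i, ‖Wc f (T x) i‖ ≤ β (Ef p f x) * ‖Wc f x i‖))
    {x : Fin n → K} (hx : IsInitialPoint p q f τ β γ x) :
    IsInitialPoint p q f τ β γ (T x) ∧ Ef p f (T x) ≤ Ef p f x := by
  obtain ⟨hxi, hxτ, hψ⟩ := hx
  obtain ⟨hstep, hW⟩ := hT x hxi hxτ
  have hE := Ef_nonneg hp f x
  have hE' := Ef_nonneg hp f (T x)
  have hβ := hβ0 _ hE hxτ
  have hγ := hγpos _ hE hxτ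
  have hpos := hβ.trans_lt hψ
  have hle : Ef p f (T x) ≤ Ef p f x :=
    (Ef_le_div_mul hn hp hpq f hxi hγ.le hβ hpos hstep hW).trans
      (mul_le_of_le_one_left hE ((div_le_one hpos).2 hψ.le))
  refine ⟨⟨injective_of_norm_sub_le hn hp hpq f hxi hγ.le hpos hstep, hle.trans_lt hxτ, ?_⟩, hle⟩
  refine (hβmono _ _ hE' hle hxτ).trans_lt (hψ.trans_le ?_)
  have := hγmono _ _ hE' hle hxτ
  have := (hγpos _ hE' (hle.trans_lt hxτ)).le
  gcongr

theorem IsInitialPoint.exists_isRootVector [CompleteSpace K] (hn : 2 ≤ n)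
    (hdeg : f.degree = (n : ℕ)) (hp : 1 ≤ p) (hpq : p⁻¹ + q⁻¹ = 1)
    (hβ0 : ∀ t, 0 ≤ t → t < τ → 0 ≤ β t) (hβmono : ∀ s t, 0 ≤ s → s ≤ t → t < τ → β s ≤ β t)
    (hγpos : ∀ t, 0 ≤ t → t < τ → 0 < γ t) (hγmono : ∀ s t, 0 ≤ s → s ≤ t → t < τ → γ s ≤ γ t)
    (hT : ∀ x : Fin n → K, Function.Injective x → Ef p f x < τ →
      (∀ i, ‖x i - T x i‖ ≤ γ (Ef p f x) * ‖Wc f x i‖) ∧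
        (∀ i, ‖Wc f (T x) i‖ ≤ β (Ef p f x) * ‖Wc f x i‖))
    {x : Fin n → K} (hx : IsInitialPoint p q f τ β γ x) :
    (∀ i j : Fin n, i ≠ j →
      Disjoint (Metric.closedBall (x i) (γ (Ef p f x) / (1 - β (Ef p f x)) * ‖Wc f x i‖))
        (Metric.closedBall (x j) (γ (Ef p f x) / (1 - β (Ef p f x)) * ‖Wc f x j‖))) ∧
    ∃ ξ : Fin n → K, Function.Injective ξ ∧ IsRootVector f ξ ∧ ∀ i,
      ξ i ∈ Metric.closedBall (x i) (γ (Ef p f x) / (1 - β (Ef p f x)) * ‖Wc f x i‖) ∧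
      eval (ξ i) f = 0 := by
  have hf : f ≠ 0 := fun h => by simp [h] at hdeg
  have hE := Ef_nonneg hp f x
  have hβ := hβ0 _ hE hx.Ef_lt
  have hγ := hγpos _ hE hx.Ef_lt
  have hβ1 : β (Ef p f x) < 1 := hx.lt_psi.trans_le (sub_le_self _ (by positivity))
  have orbit (k : ℕ) : IsInitialPoint p q f τ β γ (T^[k] x) ∧ Ef p f (T^[k] x) ≤ Ef p f x ∧
      ∀ i, ‖Wc f (T^[k] x) i‖ ≤ ‖Wc f x i‖ * β (Ef p f x) ^ k := by
    induction k with
    | zero => exact ⟨hx, le_rfl, fun i => by simp⟩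
    | succ k ih =>
      obtain ⟨hk, hEk, hWk⟩ := ih
      obtain ⟨hk', hle⟩ := hk.map hn hp hpq hβ0 hβmono hγpos hγmono hT
      rw [Function.iterate_succ_apply']
      refine ⟨hk', hle.trans hEk, fun i => ((hT _ hk.injective hk.Ef_lt).2 i).trans ?_⟩
      rw [pow_succ', mul_left_comm]
      exact mul_le_mul (hβmono _ _ (Ef_nonneg hp f _) hEk hx.Ef_lt) (hWk i) (norm_nonneg _) hβ
  obtain ⟨ξ, hξ⟩ := exists_root_of_geometric hf (y := fun k => T^[k] x)
    (fun k => (orbit k).1.injective) (c := γ (Ef p f x)) hβ hβ1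
    (fun k i => by
      obtain ⟨hk, hEk, hWk⟩ := orbit k
      rw [Function.iterate_succ_apply', mul_assoc]
      exact ((hT _ hk.injective hk.Ef_lt).1 i).trans
        (mul_le_mul (hγmono _ _ (Ef_nonneg hp f _) hEk hx.Ef_lt) (hWk i) (norm_nonneg _) hγ.le))
    fun k => (orbit k).2.2
  have hdisj (i j : Fin n) (hij : i ≠ j) := disjoint_closedBall_of_add_lt hn hp hpq f hx.injective
    hγ.le hβ1 hx.lt_psi hij
  have hmem (i : Fin n) :
      ξ i ∈ Metric.closedBall (x i) (γ (Ef p f x) / (1 - β (Ef p f x)) * ‖Wc f x i‖) :=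
    mem_closedBall_iff_norm.2 (hξ i).1
  have hinj : Function.Injective ξ := fun i j hij => by
    by_contra hne
    exact Set.disjoint_left.1 (hdisj i j hne) (hmem i) (hij ▸ hmem j)
  exact ⟨hdisj, ξ, hinj, isRootVector_of_injective hdeg hinj fun i => (hξ i).2,
    fun i => ⟨hmem i, (hξ i).2⟩⟩

end Weierstrass

/-- Proinov, Theorem 2.2 (vi). -/
theorem stmt_8 {n : ℕ} {K : Type*} [NormedField K] [CompleteSpace K] (hn : 2 ≤ n)
    (f : Polynomial K) (hdeg : f.degree = (n : ℕ))
    (p q : ENNReal) (hp : 1 ≤ p) (hpq : p⁻¹ + q⁻¹ = 1)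
    (b : ℝ) (hb : b = (2 : ℝ) ^ (ENNReal.toReal q⁻¹))
    (D : Set (Fin n → K)) (T : (Fin n → K) → Fin n → K)
    (τ : ℝ) (hτ : 0 < τ) (m : ℝ) (hm : 0 ≤ m)
    (β γ : ℝ → ℝ)
    (hβ0 : ∀ t, 0 ≤ t → t < τ → 0 ≤ β t)
    (hβmono : ∀ s t, 0 ≤ s → s ≤ t → t < τ → β s ≤ β t)
    (hβqh : ∀ l t, 0 ≤ l → l ≤ 1 → 0 ≤ t → t < τ → β (l * t) ≤ l ^ m * β t)
    (hγpos : ∀ t, 0 ≤ t → t < τ → 0 < γ t)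
    (hγmono : ∀ s t, 0 ≤ s → s ≤ t → t < τ → γ s ≤ γ t)
    (hψ : ∀ t, 0 ≤ t → t < τ → 0 < 1 - b * t * γ t)
    (habc : ∀ x : Fin n → K, Function.Injective x → Ef p f x < τ →
      x ∈ D ∧ (∀ i, ‖x i - T x i‖ ≤ γ (Ef p f x) * ‖Wc f x i‖) ∧
        (∀ i, ‖Wc f (T x) i‖ ≤ β (Ef p f x) * ‖Wc f x i‖))
    (x0 : Fin n → K) (hx0 : Function.Injective x0) (hE0 : Ef p f x0 < τ)
    (hφ : β (Ef p f x0) / (1 - b * Ef p f x0 * γ (Ef p f x0)) < 1) :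
    (∃ ξ : Fin n → K, Function.Injective ξ ∧ IsRootVector f ξ) ∧
    ∀ k : ℕ,
      (∀ i j : Fin n, i ≠ j →
        Disjoint
          (Metric.closedBall (T^[k] x0 i)
            (γ (Ef p f (T^[k] x0)) / (1 - β (Ef p f (T^[k] x0))) * ‖Wc f (T^[k] x0) i‖))
          (Metric.closedBall (T^[k] x0 j)
            (γ (Ef p f (T^[k] x0)) / (1 - β (Ef p f (T^[k] x0))) * ‖Wc f (T^[k] x0) j‖))) ∧
      (∀ i : Fin n, ∃! z : K,
        z ∈ Metric.closedBall (T^[k] x0 i)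
          (γ (Ef p f (T^[k] x0)) / (1 - β (Ef p f (T^[k] x0))) * ‖Wc f (T^[k] x0) i‖) ∧
        eval z f = 0) := by
  subst hb
  have hT (x : Fin n → K) (hx : Function.Injective x) (hE : Ef p f x < τ) := (habc x hx hE).2
  have hf : f ≠ 0 := fun h => by simp [h] at hdeg
  have h0 : IsInitialPoint p q f τ β γ x0 :=
    ⟨hx0, hE0, (div_lt_one (hψ _ (Ef_nonneg hp f x0) hE0)).1 hφ⟩
  have hk (k : ℕ) : IsInitialPoint p q f τ β γ (T^[k] x0) := by
    induction k with
    | zero => exact h0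
    | succ k ih =>
      rw [Function.iterate_succ_apply']
      exact (ih.map hn hp hpq hβ0 hβmono hγpos hγmono hT).1
  have hdisks (k : ℕ) :=
    (hk k).exists_isRootVector hn hdeg hp hpq hβ0 hβmono hγpos hγmono hT
  refine ⟨?_, fun k => ⟨(hdisks k).1, fun i => ?_⟩⟩
  · obtain ⟨-, ξ, hinj, hξ, -⟩ := hdisks 0
    exact ⟨ξ, hinj, hξ⟩
  · obtain ⟨hdisj, ξ, hinj, hroot, hξ⟩ := hdisks k
    refine ⟨ξ i, hξ i, fun z ⟨hz, hz0⟩ => ?_⟩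
    obtain ⟨j, rfl⟩ := hroot.exists_eq_of_eval_eq_zero hf hz0
    by_contra hne
    exact Set.disjoint_left.1 (hdisj i j fun hij => hne (by rw [hij])) hz (hξ j).1
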